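/- Tree approximation: let (G,∘) be a finite rooted cavity-monotone network, k ∈ ℕ, and suppose that the ball [G,∘]_{2k+2} of radius 2k+2 around the root ∘ is a tree. Fix t > 0, let x⁰ ≡ 0 and x^{m+1} := tΓ_G(x^m). Then U_{μ_∘}(x^{2k}_{i→∘} : i ∈ ∂∘) ≤ E^t_G[|𝓕 ∩ E_∘|] ≤ U_{μ_∘}(x^{2k+1}_{i→∘} : i ∈ ∂∘), where E^t_G denotes expectation under the Gibbs–Boltzmann law at activity t. -/

import Mathlib

open Finset Filter
open scoped Classical ENNReal

section LocalDefs

variable {V : Type*} [DecidableEq V]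

/-- Generating polynomial `Z(w) = Σ_{S ⊆ A} ν(S) ∏_{k∈S} w_k` of a measure `ν`
on the subsets of the ground set `A`. -/
noncomputable def lZ (A : Finset V) (ν : Finset V → ℝ) (w : V → ℝ) : ℝ :=
  ∑ S ∈ A.powerset, ν S * ∏ k ∈ S, w k

/-- Gibbs--Boltzmann probability of the event `p` under external field `w`. -/
noncomputable def lProb (A : Finset V) (ν : Finset V → ℝ) (w : V → ℝ)
    (p : Finset V → Prop) : ℝ :=
  (∑ S ∈ A.powerset.filter p, ν S * ∏ k ∈ S, w k) / lZ A ν w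

/-- The energy `U_ν(w)`, i.e. the expected cardinality of the random subset. -/
noncomputable def lEnergy (A : Finset V) (ν : Finset V → ℝ) (w : V → ℝ) : ℝ :=
  (∑ S ∈ A.powerset, (S.card : ℝ) * ν S * ∏ k ∈ S, w k) / lZ A ν w

/-- `E^w_ν[|𝓕|·1_{e∈𝓕}]`. -/
noncomputable def lEnergyIn (A : Finset V) (ν : Finset V → ℝ) (e : V) (w : V → ℝ) : ℝ :=
  (∑ S ∈ A.powerset.filter (fun S => e ∈ S), (S.card : ℝ) * ν S * ∏ k ∈ S, w k) / lZ A ν w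

/-- The cavity ratio `Γ^e_ν(w') = Z^{/e}(w') / Z^{∖e}(w')`; it only depends on the
coordinates of `w` different from `e`. -/
noncomputable def lGamma (A : Finset V) (ν : Finset V → ℝ) (e : V) (w : V → ℝ) : ℝ :=
  (∑ S ∈ (A.erase e).powerset, ν (insert e S) * ∏ k ∈ S, w k) /
  (∑ S ∈ (A.erase e).powerset, ν S * ∏ k ∈ S, w k)

/-- Rayleigh property: pairwise negative correlation under every positive external field. -/
def lRayleigh (A : Finset V) (ν : Finset V → ℝ) : Prop :=
  ∀ w : V → ℝ, (∀ k ∈ A, 0 < w k) → ∀ e ∈ A, ∀ f ∈ A, e ≠ f →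
    lProb A ν w (fun S => e ∈ S ∧ f ∈ S) ≤
      lProb A ν w (fun S => e ∈ S) * lProb A ν w (fun S => f ∈ S)

/-- Size-increasing property: every ground element positively influences the total size. -/
def lSizeInc (A : Finset V) (ν : Finset V → ℝ) : Prop :=
  ∀ w : V → ℝ, (∀ k ∈ A, 0 < w k) → ∀ e ∈ A,
    lEnergy A ν w * lProb A ν w (fun S => e ∈ S) < lEnergyIn A ν e w

/-- Cavity-monotone: nonnegative, `ν(∅) > 0`, Rayleigh and size-increasing. -/
def lCavityMonotone (A : Finset V) (ν : Finset V → ℝ) : Prop :=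
  (∀ S ∈ A.powerset, 0 ≤ ν S) ∧ 0 < ν ∅ ∧ lRayleigh A ν ∧ lSizeInc A ν

end LocalDefs

section NetworkDefs

variable {V : Type*} [DecidableEq V]

/-- The cavity operator: `(Γ_G x)_{i→j}` is the cavity ratio of the local measure `μ i`
at the edge `ij`, with external field `(x_{k→i} : k ∈ ∂i ∖ {j})`.  Local measures are
encoded as functions of the set of neighbours selected. -/
noncomputable def cavOp (G : SimpleGraph V) [G.LocallyFinite]
    (μ : V → Finset V → ℝ) (x : V → V → ℝ) (i j : V) : ℝ :=
  (∑ S ∈ ((G.neighborFinset i).erase j).powerset, μ i (insert j S) * ∏ k ∈ S, x k i) /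
  (∑ S ∈ ((G.neighborFinset i).erase j).powerset, μ i S * ∏ k ∈ S, x k i)

/-- One step of the cavity iteration at activity `t` : `x ↦ t Γ_G(x)`. -/
noncomputable def cavStep (G : SimpleGraph V) [G.LocallyFinite]
    (μ : V → Finset V → ℝ) (t : ℝ) (x : V → V → ℝ) : V → V → ℝ :=
  fun i j => t * cavOp G μ x i j

/-- The neighbours `k` of `i` such that the edge `ik` belongs to the spanning subgraph `F`;
this encodes `F ∩ E_i` as a set of neighbours. -/
noncomputable def nbrsIn (G : SimpleGraph V) [G.LocallyFinite]
    (F : Finset (Sym2 V)) (i : V) : Finset V :=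
  (G.neighborFinset i).filter (fun k => s(i, k) ∈ F)

variable [Fintype V]

/-- Global measure `μ(F) = ∏_i μ_i(F ∩ E_i)` of a spanning subgraph `F`. -/
noncomputable def gWeight (G : SimpleGraph V) [DecidableRel G.Adj]
    (μ : V → Finset V → ℝ) (F : Finset (Sym2 V)) : ℝ :=
  ∏ i : V, μ i (nbrsIn G F i)

/-- Partition function `Z(G;t) = Σ_{F ⊆ E} μ(F) t^{|F|}`. -/
noncomputable def ZG (G : SimpleGraph V) [DecidableRel G.Adj]
    (μ : V → Finset V → ℝ) (t : ℝ) : ℝ :=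
  ∑ F ∈ G.edgeFinset.powerset, gWeight G μ F * t ^ F.card

/-- Gibbs--Boltzmann probability of the event `p` at activity `t`. -/
noncomputable def gProb (G : SimpleGraph V) [DecidableRel G.Adj]
    (μ : V → Finset V → ℝ) (t : ℝ) (p : Finset (Sym2 V) → Prop) : ℝ :=
  (∑ F ∈ G.edgeFinset.powerset.filter p, gWeight G μ F * t ^ F.card) / ZG G μ t

/-- Energy `U(G;t)`, the expected size of the random spanning subgraph. -/
noncomputable def UG (G : SimpleGraph V) [DecidableRel G.Adj]
    (μ : V → Finset V → ℝ) (t : ℝ) : ℝ :=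
  (∑ F ∈ G.edgeFinset.powerset, (F.card : ℝ) * gWeight G μ F * t ^ F.card) / ZG G μ t

/-- `M(G)`, the maximum size of a spanning subgraph with positive weight. -/
noncomputable def MG (G : SimpleGraph V) [DecidableRel G.Adj]
    (μ : V → Finset V → ℝ) : ℕ :=
  (G.edgeFinset.powerset.filter (fun F => 0 < gWeight G μ F)).sup Finset.card

end NetworkDefs


section Part1
set_option linter.unusedSectionVars false
variable {V : Type*} [DecidableEq V]

theorem lZ_erase (A : Finset V) (f : Finset V → ℝ) (w : V → ℝ) {c : V} (hc : c ∈ A) :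
    lZ A f w = lZ (A.erase c) f w + w c * lZ (A.erase c) (fun S => f (insert c S)) w := by
  unfold lZ
  conv_lhs => rw [← Finset.insert_erase hc]
  rw [Finset.sum_powerset_insert (Finset.notMem_erase c A), Finset.mul_sum]
  congr 1
  refine Finset.sum_congr rfl fun S hS => ?_
  have : c ∉ S := fun h => Finset.notMem_erase c A (Finset.mem_powerset.1 hS h)
  rw [Finset.prod_insert this]; ring

theorem lZ_congr (A : Finset V) (f : Finset V → ℝ) {w w' : V → ℝ} (h : ∀ c ∈ A, w c = w' c) :
    lZ A f w = lZ A f w' := by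
  unfold lZ
  refine Finset.sum_congr rfl fun S hS => ?_
  rw [Finset.prod_congr rfl fun k hk => h k (Finset.mem_powerset.1 hS hk)]

theorem lZ_nonneg (A : Finset V) (f : Finset V → ℝ) (hf : ∀ S ∈ A.powerset, 0 ≤ f S)
    (w : V → ℝ) (hw : ∀ c ∈ A, 0 ≤ w c) : 0 ≤ lZ A f w := by
  unfold lZ
  refine Finset.sum_nonneg fun S hS => mul_nonneg (hf S hS) (Finset.prod_nonneg fun k hk => ?_)
  exact hw k (Finset.mem_powerset.1 hS hk)

theorem lZ_pos (A : Finset V) (f : Finset V → ℝ) (hf : ∀ S ∈ A.powerset, 0 ≤ f S)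
    (h0 : 0 < f ∅) (w : V → ℝ) (hw : ∀ c ∈ A, 0 ≤ w c) : 0 < lZ A f w := by
  unfold lZ
  refine Finset.sum_pos' (fun S hS => mul_nonneg (hf S hS) (Finset.prod_nonneg fun k hk => ?_))
    ⟨∅, by simp, by simpa using h0⟩
  exact hw k (Finset.mem_powerset.1 hS hk)

/-- coordinatewise antitonicity of the ratio `lZ f1 / lZ f0`. -/
def CoordAnti (A : Finset V) (f1 f0 : Finset V → ℝ) : Prop :=
  ∀ w : V → ℝ, (∀ k ∈ A, 0 < w k) → ∀ c ∈ A,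
    lZ (A.erase c) (fun S => f1 (insert c S)) w * lZ (A.erase c) f0 w ≤
    lZ (A.erase c) f1 w * lZ (A.erase c) (fun S => f0 (insert c S)) w

theorem lZ_step {A : Finset V} {f1 f0 : Finset V → ℝ} (h : CoordAnti A f1 f0)
    (w : V → ℝ) (hw : ∀ k ∈ A, 0 < w k) {c : V} (hc : c ∈ A) (y : ℝ) (hy : w c ≤ y) :
    lZ A f1 (Function.update w c y) * lZ A f0 w ≤
      lZ A f1 w * lZ A f0 (Function.update w c y) := by
  have e : ∀ f : Finset V → ℝ, lZ (A.erase c) f (Function.update w c y) = lZ (A.erase c) f w := by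
    intro f
    refine lZ_congr _ _ fun k hk => ?_
    rw [Function.update_of_ne (Finset.ne_of_mem_erase hk)]
  rw [lZ_erase A f1 (Function.update w c y) hc, lZ_erase A f0 (Function.update w c y) hc,
    lZ_erase A f1 w hc, lZ_erase A f0 w hc, e, e, e, e,
    Function.update_self]
  have := h w hw c hc
  nlinarith [mul_nonneg (sub_nonneg.2 hy) (sub_nonneg.2 this)]

theorem lZ_mono {A : Finset V} {f1 f0 : Finset V → ℝ} (h : CoordAnti A f1 f0)
    (hf : ∀ S ∈ A.powerset, 0 ≤ f0 S) (h0 : 0 < f0 ∅)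
    (w w' : V → ℝ) (hw : ∀ k ∈ A, 0 < w k) (hww : ∀ k ∈ A, w k ≤ w' k) :
    lZ A f1 w' * lZ A f0 w ≤ lZ A f1 w * lZ A f0 w' := by
  have key : ∀ C : Finset V, C ⊆ A →
      lZ A f1 (C.piecewise w' w) / lZ A f0 (C.piecewise w' w) ≤ lZ A f1 w / lZ A f0 w := by
    intro C
    induction C using Finset.induction_on with
    | empty => intro _; simp
    | insert c C hc ih =>
      intro hCA
      have hcA : c ∈ A := hCA (Finset.mem_insert_self _ _)
      refine le_trans ?_ (ih fun z hz => hCA (Finset.mem_insert_of_mem hz))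
      have hp : ∀ k ∈ A, 0 < C.piecewise w' w k := by
        intro k hk
        by_cases hkC : k ∈ C
        · simp [hkC]; exact (hw k hk).trans_le (hww k hk)
        · simp [hkC]; exact hw k hk
      have hp' : ∀ k ∈ A, 0 < (insert c C).piecewise w' w k := by
        intro k hk
        by_cases hkC : k ∈ insert c C
        · rw [Finset.piecewise_eq_of_mem _ _ _ hkC]; exact (hw k hk).trans_le (hww k hk)
        · rw [Finset.piecewise_eq_of_notMem _ _ _ hkC]; exact hw k hk
      rw [div_le_div_iff₀ (lZ_pos A f0 hf h0 _ fun k hk => (hp' k hk).le)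
        (lZ_pos A f0 hf h0 _ fun k hk => (hp k hk).le)]
      rw [Finset.piecewise_insert]
      refine lZ_step h _ hp hcA _ ?_
      simp [hc]; exact hww c hcA
  have := key A le_rfl
  have e : ∀ f : Finset V → ℝ, lZ A f (A.piecewise w' w) = lZ A f w' := fun f =>
    lZ_congr _ _ fun k hk => by simp [hk]
  rw [e, e, div_le_div_iff₀ (lZ_pos A f0 hf h0 _ fun k hk => ((hw k hk).trans_le (hww k hk)).le)
        (lZ_pos A f0 hf h0 _ fun k hk => (hw k hk).le)] at this
  exact this

/-- Homogenised generating polynomial. -/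
noncomputable def pS (A : Finset V) (f : Finset V → ℝ) (a b : V → ℝ) : ℝ :=
  ∑ S ∈ A.powerset, f S * ∏ c ∈ A, (if c ∈ S then b c else a c)

theorem pS_nonneg (A : Finset V) (f : Finset V → ℝ) (hf : ∀ S ∈ A.powerset, 0 ≤ f S)
    (a b : V → ℝ) (ha : ∀ c ∈ A, 0 ≤ a c) (hb : ∀ c ∈ A, 0 ≤ b c) : 0 ≤ pS A f a b := by
  unfold pS
  refine Finset.sum_nonneg fun S hS => mul_nonneg (hf S hS) (Finset.prod_nonneg fun k hk => ?_)
  split_ifs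
  · exact hb k hk
  · exact ha k hk

theorem pS_eq (A : Finset V) (f : Finset V → ℝ) (a b : V → ℝ) (ha : ∀ c ∈ A, 0 < a c) :
    pS A f a b = (∏ c ∈ A, a c) * lZ A f (fun c => b c / a c) := by
  unfold pS lZ
  rw [Finset.mul_sum]
  refine Finset.sum_congr rfl fun S hS => ?_
  have hSA := Finset.mem_powerset.1 hS
  have : ∏ c ∈ S, b c / a c = ∏ c ∈ A, (if c ∈ S then b c / a c else 1) := by
    rw [Finset.prod_ite_mem, Finset.inter_eq_right.2 hSA]
  rw [this, mul_left_comm, ← Finset.prod_mul_distrib]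
  congr 1
  refine Finset.prod_congr rfl fun c hc => ?_
  have := ha c hc
  split_ifs
  · field_simp
  · simp

theorem pS_cont (A : Finset V) (f : Finset V → ℝ) (a b : ℝ → V → ℝ)
    (ha : ∀ c, Continuous fun s => a s c) (hb : ∀ c, Continuous fun s => b s c) :
    Continuous fun s => pS A f (a s) (b s) := by
  unfold pS
  refine continuous_finsetSum _ fun S _ => continuous_const.mul (continuous_finsetProd _ fun c _ => ?_)
  split_ifs
  · exact hb c
  · exact ha c

theorem lZ_cont (A : Finset V) (f : Finset V → ℝ) (a : ℝ → V → ℝ)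
    (ha : ∀ c, Continuous fun s => a s c) :
    Continuous fun s => lZ A f (a s) := by
  unfold lZ
  exact continuous_finsetSum _ fun S _ => continuous_const.mul (continuous_finsetProd _ fun c _ => ha c)

theorem pS_mono_pos {A : Finset V} {f1 f0 : Finset V → ℝ} (h : CoordAnti A f1 f0)
    (hf : ∀ S ∈ A.powerset, 0 ≤ f0 S) (h0 : 0 < f0 ∅)
    (a b x : V → ℝ) (ha : ∀ k ∈ A, 0 < a k) (hb : ∀ k ∈ A, 0 < b k) (hx : ∀ k ∈ A, 0 < x k) :
    ((∀ k ∈ A, x k * a k ≤ b k) → pS A f1 a b * lZ A f0 x ≤ lZ A f1 x * pS A f0 a b) ∧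
    ((∀ k ∈ A, b k ≤ x k * a k) → lZ A f1 x * pS A f0 a b ≤ pS A f1 a b * lZ A f0 x) := by
  have hP : 0 < ∏ c ∈ A, a c := Finset.prod_pos ha
  rw [pS_eq A f1 a b ha, pS_eq A f0 a b ha]
  constructor
  · intro hk
    have := lZ_mono h hf h0 x (fun c => b c / a c) hx
      (fun k hkA => by rw [le_div_iff₀ (ha k hkA)]; exact hk k hkA)
    nlinarith [mul_le_mul_of_nonneg_left this hP.le]
  · intro hk
    have := lZ_mono h hf h0 (fun c => b c / a c) x (fun k hk => div_pos (hb k hk) (ha k hk))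
      (fun k hkA => by rw [div_le_iff₀ (ha k hkA)]; exact hk k hkA)
    nlinarith [mul_le_mul_of_nonneg_left this hP.le]

theorem pS_mono {A : Finset V} {f1 f0 : Finset V → ℝ} (h : CoordAnti A f1 f0)
    (hf : ∀ S ∈ A.powerset, 0 ≤ f0 S) (h0 : 0 < f0 ∅)
    (a b x : V → ℝ) (ha : ∀ k ∈ A, 0 ≤ a k) (hb : ∀ k ∈ A, 0 ≤ b k) (hx : ∀ k ∈ A, 0 ≤ x k) :
    ((∀ k ∈ A, x k * a k ≤ b k) → pS A f1 a b * lZ A f0 x ≤ lZ A f1 x * pS A f0 a b) ∧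
    ((∀ k ∈ A, b k ≤ x k * a k) → lZ A f1 x * pS A f0 a b ≤ pS A f1 a b * lZ A f0 x) := by
  let a' : ℝ → V → ℝ := fun s c => a c + s
  let x' : ℝ → V → ℝ := fun s c => x c + s
  let b' : ℝ → V → ℝ := fun s c => b c + ((x c + s) * (a c + s) - x c * a c)
  have ca : ∀ c, Continuous fun s => a' s c := fun c => by simp only [a']; fun_prop
  have cx : ∀ c, Continuous fun s => x' s c := fun c => by simp only [x']; fun_prop
  have cb : ∀ c, Continuous fun s => b' s c := fun c => by simp only [b']; fun_prop
  have a0 : a' 0 = a := by ext; simp [a']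
  have x0 : x' 0 = x := by ext; simp [x']
  have b0 : b' 0 = b := by ext; simp [b']
  have c1 := (pS_cont A f1 a' b' ca cb).mul (lZ_cont A f0 x' cx)
  have c2 := (lZ_cont A f1 x' cx).mul (pS_cont A f0 a' b' ca cb)
  have t1 := (c1.tendsto 0).mono_left (nhdsWithin_le_nhds (s := Set.Ioi 0))
  have t2 := (c2.tendsto 0).mono_left (nhdsWithin_le_nhds (s := Set.Ioi 0))
  simp only [Pi.mul_apply, a0, x0, b0] at t1 t2
  have hs : ∀ s : ℝ, s ∈ Set.Ioi (0:ℝ) → _ := fun s (hs : 0 < s) =>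
    pS_mono_pos h hf h0 (a' s) (b' s) (x' s)
      (fun k hk => by have := ha k hk; simp only [a']; linarith)
      (fun k hk => by
        have h1 := ha k hk; have h2 := hx k hk; have h3 := hb k hk
        simp only [b']
        nlinarith [mul_nonneg h1 hs.le, mul_nonneg h2 hs.le, mul_pos hs hs])
      (fun k hk => by have := hx k hk; simp only [x']; linarith)
  constructor
  · intro hk
    refine le_of_tendsto_of_tendsto t1 t2 ?_
    filter_upwards [self_mem_nhdsWithin] with s hsm
    refine (hs s hsm).1 fun k hkA => ?_
    have := hk k hkA
    simp only [a', b', x']; linarith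
  · intro hk
    refine le_of_tendsto_of_tendsto t2 t1 ?_
    filter_upwards [self_mem_nhdsWithin] with s hsm
    refine (hs s hsm).2 fun k hkA => ?_
    have := hk k hkA
    simp only [a', b', x']; linarith

theorem filt_sum (N : Finset V) (g : Finset V → ℝ) {e : V} (he : e ∈ N)
    {_i : DecidablePred fun S : Finset V => e ∈ S} :
    ∑ S ∈ N.powerset.filter (fun S => e ∈ S), g S =
      ∑ S ∈ (N.erase e).powerset, g (insert e S) := by
  rw [Finset.sum_filter]
  conv_lhs => rw [← Finset.insert_erase he]
  rw [Finset.sum_powerset_insert (Finset.notMem_erase e N)]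
  have : ∑ t ∈ (N.erase e).powerset, (if e ∈ t then g t else 0) = 0 :=
    Finset.sum_eq_zero fun S hS =>
      if_neg fun h => Finset.notMem_erase e N (Finset.mem_powerset.1 hS h)
  rw [this, zero_add]
  exact Finset.sum_congr rfl fun S _ => if_pos (Finset.mem_insert_self _ _)

theorem filt_lZ (N : Finset V) (f : Finset V → ℝ) (w : V → ℝ) {e : V} (he : e ∈ N)
    {_i : DecidablePred fun S : Finset V => e ∈ S} :
    ∑ S ∈ N.powerset.filter (fun S => e ∈ S), f S * ∏ k ∈ S, w k =
      w e * lZ (N.erase e) (fun S => f (insert e S)) w := by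
  rw [filt_sum N _ he, lZ, Finset.mul_sum]
  refine Finset.sum_congr rfl fun S hS => ?_
  have : e ∉ S := fun h => Finset.notMem_erase e N (Finset.mem_powerset.1 hS h)
  rw [Finset.prod_insert this]; ring

theorem filt_lZ2 (N : Finset V) (ν : Finset V → ℝ) (u : V → ℝ) {e c : V} (he : e ∈ N)
    (hc : c ∈ N.erase e) {_i : DecidablePred fun S : Finset V => e ∈ S ∧ c ∈ S} :
    ∑ S ∈ N.powerset.filter (fun S => e ∈ S ∧ c ∈ S), ν S * ∏ k ∈ S, u k =
      u e * (u c * lZ ((N.erase e).erase c) (fun S => ν (insert e (insert c S))) u) := by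
  have hce := Finset.ne_of_mem_erase hc
  have h1 := filt_lZ (N.erase e) (fun S => ν (insert e S)) u hc (_i := fun S => Finset.decidableMem c S)
  have h2 := filt_sum N (fun S => if c ∈ S then ν S * ∏ k ∈ S, u k else 0) he (_i := fun S => Finset.decidableMem e S)
  rw [Finset.sum_filter] at h1 h2
  rw [← h1, Finset.sum_filter, Finset.mul_sum]
  refine Eq.trans (Finset.sum_congr rfl fun S _ => ?_) (h2.trans ?_)
  · by_cases h : e ∈ S <;> by_cases h' : c ∈ S <;> simp [h, h']
  refine Finset.sum_congr rfl fun S hS => ?_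
  have hS' : e ∉ S := fun h => Finset.notMem_erase e N (Finset.mem_powerset.1 hS h)
  rw [Finset.prod_insert hS']
  simp only [Finset.mem_insert, hce, false_or]
  split_ifs <;> ring

theorem cm_gamma {N : Finset V} {ν : Finset V → ℝ} (h : lCavityMonotone N ν) {e : V} (he : e ∈ N) :
    CoordAnti (N.erase e) (fun S => ν (insert e S)) ν := by
  obtain ⟨h1, h2, h3, -⟩ := h
  intro w hw c hc
  have hcN := Finset.mem_of_mem_erase hc
  have hce := Finset.ne_of_mem_erase hc
  let u := Function.update w e 1
  have hu : ∀ k ∈ N, 0 < u k := by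
    intro k hk
    by_cases hke : k = e
    · subst hke; simp [u]
    · simp only [u, Function.update_of_ne hke]; exact hw k (Finset.mem_erase.2 ⟨hke, hk⟩)
  have E : ∀ f : Finset V → ℝ, lZ ((N.erase e).erase c) f w = lZ ((N.erase e).erase c) f u := by
    intro f
    refine lZ_congr _ _ fun k hk => ?_
    have : k ≠ e := Finset.ne_of_mem_erase (Finset.mem_of_mem_erase hk)
    simp only [u, Function.update_of_ne this]
  rw [E, E, E, E]
  have hR := h3 u hu e he c hcN hce.symm
  have hZ := lZ_pos N ν h1 h2 u fun k hk => (hu k hk).le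
  unfold lProb at hR
  rw [div_mul_div_comm, div_le_div_iff₀ hZ (mul_pos hZ hZ)] at hR
  rw [filt_lZ2 N ν u he hc, filt_lZ N ν u he, filt_lZ N ν u hcN, lZ_erase N ν u he,
    lZ_erase (N.erase e) ν u hc, lZ_erase (N.erase e) _ u hc, lZ_erase (N.erase c) _ u
      (Finset.mem_erase.2 ⟨hce.symm, he⟩), Finset.erase_right_comm (a := c)] at hR
  have q2 : (fun S => ν (insert c (insert e S))) = fun S => ν (insert e (insert c S)) := by
    ext S; rw [Finset.insert_comm]
  rw [q2] at hR
  have e1 := hu e he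
  have e2 := hu c hcN
  have hZ' := hZ
  rw [lZ_erase N ν u he,
    lZ_erase (N.erase e) ν u hc, lZ_erase (N.erase e) _ u hc] at hZ'
  generalize lZ ((N.erase e).erase c) ν u = A0 at *
  generalize lZ ((N.erase e).erase c) (fun S => ν (insert c S)) u = Ac at *
  generalize lZ ((N.erase e).erase c) (fun S => ν (insert e S)) u = Ae at *
  generalize lZ ((N.erase e).erase c) (fun S => ν (insert e (insert c S))) u = Aec at *
  generalize u e = p at *
  generalize u c = q at *
  have hpos : 0 < p * q * (A0 + q * Ac + p * (Ae + q * Aec)) := by positivity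
  refine le_of_mul_le_mul_left ?_ hpos
  nlinarith [hR]

theorem cm_energy {N : Finset V} {ν : Finset V → ℝ} (h : lCavityMonotone N ν) :
    CoordAnti N (fun S => - ((S.card : ℝ) * ν S)) ν := by
  obtain ⟨h1, h2, -, h4⟩ := h
  intro w hw c hc
  have hS := (h4 w hw c hc).le
  have hZ := lZ_pos N ν h1 h2 w fun k hk => (hw k hk).le
  have hE : ∑ S ∈ N.powerset, (S.card : ℝ) * ν S * ∏ k ∈ S, w k =
    lZ N (fun S => (S.card : ℝ) * ν S) w := rfl
  unfold lEnergy lProb lEnergyIn at hS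
  rw [div_mul_div_comm, div_le_div_iff₀ (mul_pos hZ hZ) hZ, filt_lZ N ν w hc, hE,
    filt_lZ N (fun S => (S.card : ℝ) * ν S) w hc] at hS
  have neg : ∀ (A : Finset V) (f : Finset V → ℝ), lZ A (fun S => - f S) w = - lZ A f w := by
    intro A f; simp [lZ]
  rw [neg, neg (N.erase c) (fun S => (S.card : ℝ) * ν S)]
  rw [lZ_erase N ν w hc, lZ_erase N (fun S => (S.card : ℝ) * ν S) w hc] at hS
  rw [lZ_erase N ν w hc] at hZ
  have e2 := hw c hc
  generalize lZ (N.erase c) (fun S => (S.card : ℝ) * ν S) w = N0 at *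
  generalize lZ (N.erase c) (fun S => ((insert c S).card : ℝ) * ν (insert c S)) w = N1 at *
  generalize lZ (N.erase c) (fun S => ν (insert c S)) w = B at *
  generalize lZ (N.erase c) ν w = A at *
  generalize w c = q at *
  have hpos : 0 < q * (A + q * B) := by positivity
  refine le_of_mul_le_mul_left ?_ hpos
  nlinarith [hS]

end Part1

section Part2
variable {V : Type*} [DecidableEq V]

/-- A rooted level structure which is tree-like up to level `M`. -/
structure LevelTree (G : SimpleGraph V) (root : V) (M : ℕ) (l : V → ℕ) (p : V → V) : Prop where
  zero_iff : ∀ v, l v = 0 ↔ v = root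
  step : ∀ u v, G.Adj u v → l u ≤ M → l v ≤ l u + 1
  ne : ∀ u v, G.Adj u v → l u ≤ M → l v ≠ l u
  padj : ∀ v, l v ≠ 0 → l v ≤ M → G.Adj v (p v) ∧ l (p v) + 1 = l v
  puniq : ∀ v u, l v ≤ M → G.Adj v u → l u + 1 = l v → u = p v

theorem exists_levelTree (G : SimpleGraph V) (root : V) (M : ℕ)
    (hball : (G.induce {v : V | G.Reachable root v ∧ G.dist root v ≤ M}).IsTree) :
    ∃ l p, LevelTree G root M l p := by
  set s := {v : V | G.Reachable root v ∧ G.dist root v ≤ M} with hs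
  have hr : root ∈ s := by simp [hs]
  set T := G.induce s with hT
  let l : V → ℕ := fun v => if G.Reachable root v then G.dist root v else M + 1
  have hls : ∀ v, l v ≤ M ↔ v ∈ s := by
    intro v
    by_cases h : G.Reachable root v <;> simp [l, hs, h]
  have hld : ∀ v ∈ s, l v = G.dist root v := by
    intro v hv; simp [l, hv.1]
  have hT1 : ∀ v (hv : v ∈ s), T.dist ⟨root, hr⟩ ⟨v, hv⟩ = G.dist root v := by
    intro v hv
    apply le_antisymm
    · obtain ⟨q, hq⟩ := hv.1.exists_walk_length_eq_dist
      have hsup : ∀ x ∈ q.support, x ∈ s := by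
        intro x hx
        refine ⟨⟨q.takeUntil x hx⟩, ?_⟩
        refine le_trans (SimpleGraph.dist_le (q.takeUntil x hx)) ?_
        refine le_trans (q.length_takeUntil_le_length hx) ?_
        rw [hq]; exact hv.2
      have := SimpleGraph.dist_le (q.induce s hsup)
      rw [← hq]
      refine this.trans_eq ?_
      rw [← SimpleGraph.Walk.length_map (SimpleGraph.Embedding.induce s).toHom,
        SimpleGraph.Walk.map_induce]
      rfl
    · obtain ⟨q, hq⟩ := hball.connected.exists_walk_length_eq_dist ⟨root, hr⟩ ⟨v, hv⟩
      rw [← hq]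
      have := SimpleGraph.dist_le (q.map (SimpleGraph.Embedding.induce s).toHom)
      rw [SimpleGraph.Walk.length_map] at this
      exact this
  have hadjT : ∀ {u v} (hu : u ∈ s) (hv : v ∈ s), G.Adj u v → T.Adj ⟨u, hu⟩ ⟨v, hv⟩ := by
    intro u v hu hv h; simpa [hT] using h
  have hex : ∀ v, l v ≠ 0 → l v ≤ M → ∃ u, G.Adj v u ∧ l u + 1 = l v := by
    intro v h0 hM
    have hv := (hls v).1 hM
    rw [hld v hv] at h0 ⊢
    obtain ⟨q, hq⟩ := hv.1.exists_walk_length_eq_dist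
    have hnn : ¬ q.Nil := by
      intro h; rw [← SimpleGraph.Walk.length_eq_zero_iff] at h; omega
    have ha := q.adj_penultimate hnn
    have hlen : q.dropLast.length + 1 = q.length := by
      rw [SimpleGraph.Walk.length_dropLast]
      omega
    have h1 : G.dist root q.penultimate ≤ q.dropLast.length := SimpleGraph.dist_le _
    have hr2 : G.Reachable root q.penultimate := ⟨q.dropLast⟩
    have hps : q.penultimate ∈ s := ⟨hr2, by have := hv.2; omega⟩
    refine ⟨q.penultimate, ha.symm, ?_⟩
    rw [hld _ hps]
    have : G.dist root v ≤ G.dist root q.penultimate + 1 := by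
      obtain ⟨q', hq'⟩ := hr2.exists_walk_length_eq_dist
      have := SimpleGraph.dist_le (q'.concat ha)
      simpa [hq'] using this
    omega
  have hun : ∀ v u u', l v ≤ M → G.Adj v u → l u + 1 = l v → G.Adj v u' → l u' + 1 = l v →
      u = u' := by
    intro v u u' hM h1 h2 h1' h2'
    have hv := (hls v).1 hM
    have hu := (hls u).1 (by omega)
    have hu' := (hls u').1 (by omega)
    rw [hld _ hv, hld _ hu] at h2
    rw [hld _ hv, hld _ hu'] at h2'
    obtain ⟨q, hq⟩ := hball.connected.exists_walk_length_eq_dist ⟨root, hr⟩ ⟨u, hu⟩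
    obtain ⟨q', hq'⟩ := hball.connected.exists_walk_length_eq_dist ⟨root, hr⟩ ⟨u', hu'⟩
    have P := (q.concat (hadjT hu hv h1.symm)).isPath_of_length_eq_dist (by
      rw [SimpleGraph.Walk.length_concat, hq, hT1, hT1, h2])
    have P' := (q'.concat (hadjT hu' hv h1'.symm)).isPath_of_length_eq_dist (by
      rw [SimpleGraph.Walk.length_concat, hq', hT1, hT1, h2'])
    have := (hball.isAcyclic.subsingleton_path _ _).elim ⟨_, P⟩ ⟨_, P'⟩
    have := congrArg (fun z => z.1.penultimate) this
    simpa using this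
  choose! p hp using hex
  refine ⟨l, p, ?_, ?_, ?_, hp, ?_⟩
  · intro v
    by_cases h : G.Reachable root v
    · simp only [l, h, if_true, h.dist_eq_zero_iff]; exact eq_comm
    · simp only [l, h, if_false]
      constructor
      · intro h; omega
      · rintro rfl; exact absurd (SimpleGraph.Reachable.refl _) h
  · intro u v h hM
    have hu := (hls u).1 hM
    have : G.Reachable root v := hu.1.trans h.reachable
    rw [hld u hu]
    simp only [l, this, if_true]
    obtain ⟨q', hq'⟩ := hu.1.exists_walk_length_eq_dist
    have := SimpleGraph.dist_le (q'.concat h)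
    simpa [hq'] using this
  · intro u v h hM heq
    have hu := (hls u).1 hM
    have hv := (hls v).1 (heq ▸ hM)
    rw [hld u hu, hld v hv] at heq
    have := hball.dist_ne_of_adj ⟨root, hr⟩ (hadjT hu hv h)
    rw [hT1, hT1] at this
    exact this heq.symm
  · intro v u hM h1 h2
    have := hp v (by omega) hM
    exact hun v u (p v) hM h1 h2 this.1 this.2

end Part2

section Part3
set_option linter.unusedSectionVars false

theorem sum_powerset_union' {α : Type*} [DecidableEq α] (A B : Finset α) (hAB : Disjoint A B)
    (f : Finset α → ℝ) :
    ∑ X ∈ (A ∪ B).powerset, f X = ∑ X ∈ A.powerset, ∑ Y ∈ B.powerset, f (X ∪ Y) := by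
  induction B using Finset.induction_on generalizing f with
  | empty => simp
  | insert c B hc ih =>
    rw [Finset.disjoint_insert_right] at hAB
    rw [Finset.union_insert, Finset.sum_powerset_insert (by simp [hAB.1, hc]), ih hAB.2,
      ih hAB.2 (fun X => f (insert c X)), ← Finset.sum_add_distrib]
    refine Finset.sum_congr rfl fun X _ => ?_
    rw [Finset.sum_powerset_insert hc]
    simp only [Finset.union_insert]

theorem sum_powerset_image' {α β : Type*} [DecidableEq α] [DecidableEq β] (A : Finset α)
    (e : α → β) (he : Set.InjOn e A) (f : Finset β → ℝ) :
    ∑ X ∈ (A.image e).powerset, f X = ∑ X ∈ A.powerset, f (X.image e) := by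
  rw [Finset.powerset_image, Finset.sum_image]
  intro X hX Y hY hXY
  have hX' := Finset.mem_powerset.1 hX
  have hY' := Finset.mem_powerset.1 hY
  refine Finset.coe_injective ((he.image_eq_image_iff (by exact_mod_cast hX')
    (by exact_mod_cast hY')).1 ?_)
  exact_mod_cast congrArg (fun z : Finset β => (z : Set β)) hXY

theorem prod_fiber {α : Type*} [DecidableEq α] (A : Finset α) (C : α → Finset α)
    (hC : ∀ v ∈ A, ∀ w ∈ A, v ≠ w → Disjoint (C v) (C w)) (g : α → Finset α → ℝ) :
    ∑ Y ∈ (A.biUnion C).powerset, ∏ v ∈ A, g v (Y ∩ C v) =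
      ∏ v ∈ A, ∑ S ∈ (C v).powerset, g v S := by
  induction A using Finset.induction_on with
  | empty => simp
  | insert c A hc ih =>
    have hd : ∀ v ∈ A, Disjoint (C c) (C v) := fun v hv =>
      hC c (Finset.mem_insert_self _ _) v (Finset.mem_insert_of_mem hv) (by rintro rfl; exact hc hv)
    rw [Finset.biUnion_insert, sum_powerset_union' _ _ (by
      rw [Finset.disjoint_biUnion_right]; exact hd), Finset.prod_insert hc, ← ih (fun v hv w hw =>
        hC v (Finset.mem_insert_of_mem hv) w (Finset.mem_insert_of_mem hw)), Finset.sum_mul]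
    refine Finset.sum_congr rfl fun X hX => ?_
    rw [Finset.mul_sum]
    refine Finset.sum_congr rfl fun Y hY => ?_
    have hX := Finset.mem_powerset.1 hX
    have hY := Finset.mem_powerset.1 hY
    rw [Finset.prod_insert hc]
    congr 1
    · congr 1
      ext z
      simp only [Finset.mem_inter, Finset.mem_union]
      constructor
      · rintro ⟨h | h, hz⟩
        · exact h
        · obtain ⟨v, hv, hzv⟩ := Finset.mem_biUnion.1 (hY h)
          exact absurd hzv (Finset.disjoint_left.1 (hd v hv) hz)
      · intro h; exact ⟨Or.inl h, hX h⟩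
    · refine Finset.prod_congr rfl fun v hv => ?_
      congr 1
      ext z
      simp only [Finset.mem_inter, Finset.mem_union]
      constructor
      · rintro ⟨h | h, hz⟩
        · exact absurd hz (Finset.disjoint_left.1 (hd v hv) (hX h))
        · exact ⟨h, hz⟩
      · rintro ⟨h, hz⟩; exact ⟨Or.inr h, hz⟩

variable {V : Type*} [Fintype V] [DecidableEq V] (G : SimpleGraph V) [DecidableRel G.Adj]
  (μ : V → Finset V → ℝ) (t : ℝ) (root : V) (l : V → ℕ) (p : V → V)

def chd (v : V) : Finset V := (G.neighborFinset v).filter (fun u => l u = l v + 1)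
def Lay (n : ℕ) : Finset V := Finset.univ.filter (fun v => l v = n)
def BB (n : ℕ) : Finset V := Finset.univ.filter (fun v => 1 ≤ l v ∧ l v ≤ n)

noncomputable def psi (v : V) (X : Finset V) : ℝ :=
  if v ∈ X then t * μ v (insert (p v) (X ∩ chd G l v)) else μ v (X ∩ chd G l v)

noncomputable def TT (n : ℕ) (H : Finset V → ℝ) (a b : V → ℝ) : ℝ :=
  ∑ X ∈ (BB l (n + 1)).powerset, H (X ∩ chd G l root) * (∏ v ∈ BB l n, psi G μ t l p v X) *
    ∏ v ∈ Lay l (n + 1), if v ∈ X then b v else a v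

noncomputable def na (a b : V → ℝ) (v : V) : ℝ := pS (chd G l v) (μ v) a b
noncomputable def nb (a b : V → ℝ) (v : V) : ℝ :=
  t * pS (chd G l v) (fun S => μ v (insert (p v) S)) a b

variable {G μ t root l p} {M : ℕ}

theorem chd_parent (h : LevelTree G root M l p) {v u : V} (hu : u ∈ chd G l v) (hM : l u ≤ M) :
    v = p u := by
  simp only [chd, Finset.mem_filter, SimpleGraph.mem_neighborFinset] at hu
  exact h.puniq u v hM hu.1.symm hu.2.symm

theorem chd_eq (h : LevelTree G root M l p) {v : V} (h1 : 1 ≤ l v) (hM : l v < M) :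
    chd G l v = (G.neighborFinset v).erase (p v) := by
  ext u
  simp only [chd, Finset.mem_filter, SimpleGraph.mem_neighborFinset, Finset.mem_erase]
  have hp := h.padj v (by omega) hM.le
  constructor
  · rintro ⟨ha, hl⟩
    refine ⟨?_, ha⟩
    rintro rfl; omega
  · rintro ⟨hne, ha⟩
    refine ⟨ha, ?_⟩
    have h2 := h.step v u ha hM.le
    have h3 := h.ne v u ha hM.le
    have h4 := h.step u v ha.symm (by omega)
    by_contra hcon
    exact hne (h.puniq v u hM.le ha (by omega))

theorem chd_root (h : LevelTree G root M l p) : chd G l root = G.neighborFinset root := by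
  ext u
  simp only [chd, Finset.mem_filter, SimpleGraph.mem_neighborFinset, and_iff_left_iff_imp]
  intro ha
  have h0 := (h.zero_iff root).2 rfl
  have h2 := h.step root u ha (by omega)
  have h3 := h.ne root u ha (by omega)
  omega

theorem Lay_succ (h : LevelTree G root M l p) {n : ℕ} (hn : n + 1 ≤ M) :
    Lay l (n + 1) = (Lay l n).biUnion (chd G l) := by
  ext u
  simp only [Lay, chd, Finset.mem_filter, Finset.mem_univ, true_and, Finset.mem_biUnion,
    SimpleGraph.mem_neighborFinset]
  constructor
  · intro hu
    have := h.padj u (by omega) (by omega)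
    exact ⟨p u, by omega, this.1.symm, by omega⟩
  · rintro ⟨v, hv, -, hu⟩; omega

theorem BB_succ (n : ℕ) : BB l (n + 1) = BB l n ∪ Lay l (n + 1) := by
  ext v; simp only [BB, Lay, Finset.mem_filter, Finset.mem_univ, true_and, Finset.mem_union]; omega

theorem BB_Lay_disj (n : ℕ) : Disjoint (BB l n) (Lay l (n + 1)) := by
  rw [Finset.disjoint_left]
  intro v; simp only [BB, Lay, Finset.mem_filter, Finset.mem_univ, true_and]; omega

theorem chd_disj (h : LevelTree G root M l p) {n : ℕ} (hn : n + 1 ≤ M) :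
    ∀ v ∈ Lay l n, ∀ w ∈ Lay l n, v ≠ w → Disjoint (chd G l v) (chd G l w) := by
  intro v hv w hw hvw
  rw [Finset.disjoint_left]
  intro u hu hu'
  have e : l u ≤ M := by
    simp only [Lay, chd, Finset.mem_filter, Finset.mem_univ, true_and] at hv hu; omega
  exact hvw ((chd_parent h hu e).trans (chd_parent h hu' e).symm)

theorem TT_step (h : LevelTree G root M l p) {n : ℕ} (hn : n + 2 ≤ M) (H : Finset V → ℝ)
    (a b : V → ℝ) :
    TT G μ t root l p (n + 1) H a b = TT G μ t root l p n H (na G μ l a b) (nb G μ t l p a b) := by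
  unfold TT
  have h0 := (h.zero_iff root).2 rfl
  rw [BB_succ (n + 1), sum_powerset_union' _ _ (BB_Lay_disj (n + 1))]
  refine Finset.sum_congr rfl fun X hX => ?_
  have hX := Finset.mem_powerset.1 hX
  have hcap : ∀ v, l v ≤ n → ∀ Y ∈ (Lay l (n + 2)).powerset, (X ∪ Y) ∩ chd G l v = X ∩ chd G l v := by
    intro v hv Y hY
    have hY := Finset.mem_powerset.1 hY
    rw [Finset.union_inter_distrib_right]
    have : Y ∩ chd G l v = ∅ := by
      rw [← Finset.disjoint_iff_inter_eq_empty, Finset.disjoint_left]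
      intro u hu hu'
      have := hY hu
      simp only [Lay, chd, Finset.mem_filter, Finset.mem_univ, true_and] at this hu'
      omega
    rw [this, Finset.union_empty]
  have hmem : ∀ v, l v ≤ n + 1 → ∀ Y ∈ (Lay l (n + 2)).powerset, (v ∈ X ∪ Y ↔ v ∈ X) := by
    intro v hv Y hY
    have hY := Finset.mem_powerset.1 hY
    rw [Finset.mem_union, or_iff_left]
    intro hh
    have := hY hh
    simp only [Lay, Finset.mem_filter, Finset.mem_univ, true_and] at this
    omega
  have hcap2 : ∀ v ∈ Lay l (n + 1), ∀ Y, (X ∪ Y) ∩ chd G l v = Y ∩ chd G l v := by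
    intro v hv Y
    rw [Finset.union_inter_distrib_right]
    have : X ∩ chd G l v = ∅ := by
      rw [← Finset.disjoint_iff_inter_eq_empty, Finset.disjoint_left]
      intro u hu hu'
      have := hX hu
      simp only [Lay, BB, chd, Finset.mem_filter, Finset.mem_univ, true_and] at this hu' hv
      omega
    rw [this, Finset.empty_union]
  let g : V → Finset V → ℝ := fun v S =>
    (if v ∈ X then t * μ v (insert (p v) S) else μ v S) *
      ∏ c ∈ chd G l v, (if c ∈ S then b c else a c)
  have hterm : ∀ Y ∈ (Lay l (n + 1 + 1)).powerset,
      H ((X ∪ Y) ∩ chd G l root) * (∏ v ∈ BB l (n + 1), psi G μ t l p v (X ∪ Y)) *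
        (∏ v ∈ Lay l (n + 1 + 1), if v ∈ X ∪ Y then b v else a v) =
      (H (X ∩ chd G l root) * (∏ v ∈ BB l n, psi G μ t l p v X)) *
        ∏ v ∈ Lay l (n + 1), g v (Y ∩ chd G l v) := by
    intro Y hY
    rw [hcap root (by omega) Y hY, BB_succ n, Finset.prod_union (BB_Lay_disj n),
      Lay_succ h (n := n + 1) (by omega), Finset.prod_biUnion (by
        intro v hv w hw hvw
        exact chd_disj h (n := n + 1) (by omega) v hv w hw hvw)]
    have e1 : ∏ v ∈ BB l n, psi G μ t l p v (X ∪ Y) = ∏ v ∈ BB l n, psi G μ t l p v X := by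
      refine Finset.prod_congr rfl fun v hv => ?_
      simp only [BB, Finset.mem_filter, Finset.mem_univ, true_and] at hv
      unfold psi
      rw [hcap v hv.2 Y hY]
      simp only [hmem v (by omega) Y hY]
    rw [e1]
    have e2 : (∏ v ∈ Lay l (n + 1), psi G μ t l p v (X ∪ Y)) *
        (∏ v ∈ Lay l (n + 1), ∏ c ∈ chd G l v, if c ∈ X ∪ Y then b c else a c) =
        ∏ v ∈ Lay l (n + 1), g v (Y ∩ chd G l v) := by
      rw [← Finset.prod_mul_distrib]
      refine Finset.prod_congr rfl fun v hv => ?_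
      have hv' : l v = n + 1 := by
        simpa only [Lay, Finset.mem_filter, Finset.mem_univ, true_and] using hv
      unfold psi
      simp only [g]
      rw [hcap2 v hv Y]
      simp only [hmem v (by omega) Y hY]
      congr 1
      refine Finset.prod_congr rfl fun c hc => ?_
      have : c ∈ X ∪ Y ↔ c ∈ Y ∩ chd G l v := by
        rw [← hcap2 v hv Y, Finset.mem_inter, and_iff_left hc]
      simp only [this]
    rw [← e2]; ring
  rw [Finset.sum_congr rfl hterm, ← Finset.mul_sum, Lay_succ h (n := n + 1) (by omega),
    prod_fiber _ _ (chd_disj h (n := n + 1) (by omega))]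
  congr 1
  refine Finset.prod_congr rfl fun v _ => ?_
  by_cases hv : v ∈ X
  · simp only [g, hv, if_true, nb, pS, Finset.mul_sum, mul_assoc]
  · simp only [g, hv, if_false, na, pS]

theorem TT_zero (h : LevelTree G root M l p) (hM : 1 ≤ M) (H : Finset V → ℝ) (a b : V → ℝ) :
    TT G μ t root l p 0 H a b = pS (G.neighborFinset root) H a b := by
  have e0 : BB l 0 = ∅ := by
    ext v; simp only [BB, Finset.mem_filter, Finset.mem_univ, true_and, Finset.notMem_empty, iff_false]; omega
  have e1 : Lay l 0 = {root} := by
    ext v; simp only [Lay, Finset.mem_filter, Finset.mem_univ, true_and, Finset.mem_singleton]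
    exact h.zero_iff v
  have e2 : Lay l (0 + 1) = G.neighborFinset root := by
    rw [Lay_succ h (by omega), e1, Finset.singleton_biUnion, chd_root h]
  unfold TT pS
  rw [BB_succ, e0, Finset.empty_union, e2, chd_root h]
  refine Finset.sum_congr rfl fun X hX => ?_
  rw [Finset.inter_eq_left.2 (Finset.mem_powerset.1 hX)]
  simp

/-- cavity iterates -/
noncomputable def XX (G : SimpleGraph V) [DecidableRel G.Adj] (μ : V → Finset V → ℝ) (t : ℝ)
    (j : ℕ) : V → V → ℝ := (cavStep G μ t)^[j] (fun _ _ => 0)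

theorem XX_succ (j : ℕ) (v w : V) : XX G μ t (j + 1) v w =
    t * (lZ ((G.neighborFinset v).erase w) (fun S => μ v (insert w S)) (fun k => XX G μ t j k v) /
      lZ ((G.neighborFinset v).erase w) (μ v) (fun k => XX G μ t j k v)) := by
  unfold XX
  rw [Function.iterate_succ_apply']
  rfl

theorem ins_nonneg (hcm : ∀ i : V, lCavityMonotone (G.neighborFinset i) (μ i)) {v w : V}
    (hw : G.Adj v w) : ∀ S ∈ ((G.neighborFinset v).erase w).powerset, 0 ≤ μ v (insert w S) := by
  intro S hS
  refine (hcm v).1 _ (Finset.mem_powerset.2 ?_)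
  refine Finset.insert_subset (by simpa using hw) ?_
  exact (Finset.mem_powerset.1 hS).trans (Finset.erase_subset _ _)

theorem er_nonneg (hcm : ∀ i : V, lCavityMonotone (G.neighborFinset i) (μ i)) {v w : V} :
    ∀ S ∈ ((G.neighborFinset v).erase w).powerset, 0 ≤ μ v S := by
  intro S hS
  refine (hcm v).1 _ (Finset.mem_powerset.2 ?_)
  exact (Finset.mem_powerset.1 hS).trans (Finset.erase_subset _ _)

theorem XX_nonneg (hcm : ∀ i : V, lCavityMonotone (G.neighborFinset i) (μ i)) (ht : 0 < t) (j : ℕ) :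
    ∀ v w, G.Adj v w → 0 ≤ XX G μ t j v w := by
  induction j with
  | zero => intro v w _; simp [XX]
  | succ j ih =>
    intro v w hvw
    rw [XX_succ]
    have hx : ∀ c ∈ (G.neighborFinset v).erase w, 0 ≤ XX G μ t j c v := by
      intro c hc
      have hc' := Finset.mem_of_mem_erase hc
      rw [SimpleGraph.mem_neighborFinset] at hc'
      exact ih c v hc'.symm
    exact mul_nonneg ht.le (div_nonneg (lZ_nonneg _ _ (ins_nonneg hcm hvw) _ hx)
      (lZ_nonneg _ _ (er_nonneg hcm) _ hx))

theorem bound_step (hcm : ∀ i : V, lCavityMonotone (G.neighborFinset i) (μ i)) (ht : 0 < t)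
    (h : LevelTree G root M l p) {n : ℕ} (hn : n + 2 ≤ M) (a b : V → ℝ)
    (ha : ∀ v ∈ Lay l (n + 2), 0 ≤ a v) (hb : ∀ v ∈ Lay l (n + 2), 0 ≤ b v) (j : ℕ) :
    (∀ v ∈ Lay l (n + 1), 0 ≤ na G μ l a b v) ∧ (∀ v ∈ Lay l (n + 1), 0 ≤ nb G μ t l p a b v) ∧
    ((∀ v ∈ Lay l (n + 2), XX G μ t j v (p v) * a v ≤ b v) →
      ∀ v ∈ Lay l (n + 1), nb G μ t l p a b v ≤ XX G μ t (j + 1) v (p v) * na G μ l a b v) ∧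
    ((∀ v ∈ Lay l (n + 2), b v ≤ XX G μ t j v (p v) * a v) →
      ∀ v ∈ Lay l (n + 1), XX G μ t (j + 1) v (p v) * na G μ l a b v ≤ nb G μ t l p a b v) := by
  have key : ∀ v ∈ Lay l (n + 1), G.Adj v (p v) ∧ chd G l v = (G.neighborFinset v).erase (p v) ∧
      ∀ c ∈ (G.neighborFinset v).erase (p v), c ∈ Lay l (n + 2) ∧ p c = v ∧ G.Adj c v := by
    intro v hv
    simp only [Lay, Finset.mem_filter, Finset.mem_univ, true_and] at hv
    have hc := chd_eq h (v := v) (by omega) (by omega)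
    refine ⟨(h.padj v (by omega) (by omega)).1, hc, fun c hcm => ?_⟩
    rw [← hc] at hcm
    have hcm' := hcm
    simp only [chd, Finset.mem_filter, SimpleGraph.mem_neighborFinset] at hcm'
    refine ⟨?_, (chd_parent h hcm (by omega)).symm, hcm'.1.symm⟩
    simp only [Lay, Finset.mem_filter, Finset.mem_univ, true_and]; omega
  have main : ∀ v ∈ Lay l (n + 1), _ := fun v hv =>
    pS_mono (cm_gamma (hcm v) (e := p v) (by simpa using (key v hv).1)) (er_nonneg hcm) (hcm v).2.1
      a b (fun k => XX G μ t j k v) (fun k hk => ha k ((key v hv).2.2 k hk).1)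
      (fun k hk => hb k ((key v hv).2.2 k hk).1)
      (fun k hk => XX_nonneg hcm ht j k v ((key v hv).2.2 k hk).2.2)
  have hpos : ∀ v ∈ Lay l (n + 1), 0 < lZ ((G.neighborFinset v).erase (p v)) (μ v)
      (fun k => XX G μ t j k v) := fun v hv => lZ_pos _ _ (er_nonneg hcm) (hcm v).2.1 _
      (fun k hk => XX_nonneg hcm ht j k v ((key v hv).2.2 k hk).2.2)
  refine ⟨fun v hv => ?_, fun v hv => ?_, fun hB v hv => ?_, fun hB v hv => ?_⟩
  · unfold na
    rw [(key v hv).2.1]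
    exact pS_nonneg _ _ (er_nonneg hcm) _ _ (fun k hk => ha k ((key v hv).2.2 k hk).1)
      (fun k hk => hb k ((key v hv).2.2 k hk).1)
  · unfold nb
    rw [(key v hv).2.1]
    exact mul_nonneg ht.le (pS_nonneg _ _ (ins_nonneg hcm (key v hv).1) _ _
      (fun k hk => ha k ((key v hv).2.2 k hk).1) (fun k hk => hb k ((key v hv).2.2 k hk).1))
  · have := (main v hv).1 (fun k hk => by
      have h1 := (key v hv).2.2 k hk
      have h2 := hB k h1.1
      rwa [h1.2.1] at h2)
    unfold na nb
    rw [XX_succ, (key v hv).2.1, mul_assoc]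
    refine mul_le_mul_of_nonneg_left ?_ ht.le
    rw [div_mul_eq_mul_div, le_div_iff₀ (hpos v hv)]
    exact this
  · have := (main v hv).2 (fun k hk => by
      have h1 := (key v hv).2.2 k hk
      have h2 := hB k h1.1
      rwa [h1.2.1] at h2)
    unfold na nb
    rw [XX_succ, (key v hv).2.1, mul_assoc]
    refine mul_le_mul_of_nonneg_left ?_ ht.le
    rw [div_mul_eq_mul_div, div_le_iff₀ (hpos v hv)]
    exact this

theorem bound_even (hcm : ∀ i : V, lCavityMonotone (G.neighborFinset i) (μ i)) (ht : 0 < t)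
    (h : LevelTree G root M l p) (k : ℕ) : 2 * k + 1 ≤ M → ∀ (a b : V → ℝ)
    (_ : ∀ v ∈ Lay l (2 * k + 1), 0 ≤ a v) (_ : ∀ v ∈ Lay l (2 * k + 1), 0 ≤ b v) (i j : ℕ)
    (_ : ∀ v ∈ Lay l (2 * k + 1), XX G μ t i v (p v) * a v ≤ b v)
    (_ : ∀ v ∈ Lay l (2 * k + 1), b v ≤ XX G μ t j v (p v) * a v),
    ∃ a0 b0 : V → ℝ, (∀ H, TT G μ t root l p (2 * k) H a b = pS (G.neighborFinset root) H a0 b0) ∧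
      (∀ v ∈ G.neighborFinset root, 0 ≤ a0 v ∧ 0 ≤ b0 v ∧
        XX G μ t (i + 2 * k) v root * a0 v ≤ b0 v ∧ b0 v ≤ XX G μ t (j + 2 * k) v root * a0 v) := by
  induction k with
  | zero =>
    intro hM a b ha hb i j hi hj
    refine ⟨a, b, fun H => TT_zero h (by omega) H a b, fun v hv => ?_⟩
    have hv1 : v ∈ Lay l (2 * 0 + 1) := by
      rw [← chd_root h] at hv
      have h0 := (h.zero_iff root).2 rfl
      simp only [chd, Lay, Finset.mem_filter, Finset.mem_univ, true_and] at hv ⊢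
      omega
    have hp : p v = root := by
      rw [← chd_root h] at hv
      refine (chd_parent h hv ?_).symm
      simp only [Lay, Finset.mem_filter, Finset.mem_univ, true_and] at hv1
      omega
    have h1 := hi v hv1
    have h2 := hj v hv1
    rw [hp] at h1 h2
    exact ⟨ha v hv1, hb v hv1, h1, h2⟩
  | succ k ih =>
    intro hM a b ha hb i j hi hj
    have s1 := bound_step (n := 2 * k + 1) hcm ht h (by omega) a b ha hb
    have s1i := (s1 i).2.2.1 hi
    have s1j := (s1 j).2.2.2 hj
    have s2 := bound_step (n := 2 * k) hcm ht h (by omega) _ _ (s1 i).1 (s1 i).2.1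
    have s2i := (s2 (i + 1)).2.2.2 s1i
    have s2j := (s2 (j + 1)).2.2.1 s1j
    obtain ⟨a0, b0, hT, hB⟩ := ih (by omega) _ _ (s2 i).1 (s2 i).2.1 (i + 2) (j + 2) s2i s2j
    refine ⟨a0, b0, fun H => ?_, fun v hv => ?_⟩
    · rw [← hT H, ← TT_step h (by omega), ← TT_step h (by omega)]
      rfl
    · have := hB v hv
      rw [show i + 2 * (k + 1) = i + 2 + 2 * k by ring, show j + 2 * (k + 1) = j + 2 + 2 * k by ring]
      exact this

theorem bound_final (hcm : ∀ i : V, lCavityMonotone (G.neighborFinset i) (μ i)) (ht : 0 < t)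
    (k : ℕ) (h : LevelTree G root (2 * k + 2) l p) (a b : V → ℝ)
    (ha : ∀ v ∈ Lay l (2 * k + 2), 0 ≤ a v) (hb : ∀ v ∈ Lay l (2 * k + 2), 0 ≤ b v) :
    ∃ a0 b0 : V → ℝ,
      (∀ H, TT G μ t root l p (2 * k + 1) H a b = pS (G.neighborFinset root) H a0 b0) ∧
      (∀ v ∈ G.neighborFinset root, 0 ≤ a0 v ∧ 0 ≤ b0 v ∧
        XX G μ t (2 * k) v root * a0 v ≤ b0 v ∧ b0 v ≤ XX G μ t (2 * k + 1) v root * a0 v) := by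
  have s1 := bound_step (n := 2 * k) hcm ht h le_rfl a b ha hb 0
  have s1i := s1.2.2.1 (by intro v hv; simpa [XX] using hb v hv)
  obtain ⟨a0, b0, hT, hB⟩ := bound_even hcm ht h k (by omega) _ _ s1.1 s1.2.1 0 (0 + 1)
    (by intro v hv; simpa [XX] using s1.2.1 v hv) s1i
  refine ⟨a0, b0, fun H => ?_, fun v hv => ?_⟩
  · rw [← hT H, ← TT_step h (by omega)]
  · have := hB v hv
    rw [show 0 + 2 * k = 2 * k by ring, show 0 + 1 + 2 * k = 2 * k + 1 by ring] at this
    exact this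

end Part3

section Part4
variable {V : Type*} [Fintype V] [DecidableEq V] {G : SimpleGraph V} [DecidableRel G.Adj]
  {μ : V → Finset V → ℝ} {t : ℝ} {root : V} {l : V → ℕ} {p : V → V} {m : ℕ}

theorem mem_nbrsIn' (R : Finset (Sym2 V)) (v u : V) :
    u ∈ nbrsIn G R v ↔ G.Adj v u ∧ s(v, u) ∈ R := by
  simp [nbrsIn]

theorem mem_nbrs_union (R : Finset (Sym2 V)) (X : Finset V) (v u : V) :
    u ∈ nbrsIn G (R ∪ X.image (fun x => s(x, p x))) v ↔
      G.Adj v u ∧ (s(v, u) ∈ R ∨ (v ∈ X ∧ u = p v) ∨ (u ∈ X ∧ v = p u)) := by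
  rw [mem_nbrsIn']
  simp only [Finset.mem_union, Finset.mem_image, Sym2.eq_iff]
  refine and_congr_right fun _ => or_congr_right ⟨?_, ?_⟩
  · rintro ⟨x, hx, ⟨rfl, h⟩ | ⟨rfl, h⟩⟩
    · exact Or.inl ⟨hx, h.symm⟩
    · exact Or.inr ⟨hx, h.symm⟩
  · rintro (⟨h, rfl⟩ | ⟨h, rfl⟩)
    · exact ⟨v, h, Or.inl ⟨rfl, rfl⟩⟩
    · exact ⟨u, h, Or.inr ⟨rfl, rfl⟩⟩

theorem low_edge (h : LevelTree G root (m + 1) l p) {v u : V} (hv : l v ≤ m) (ha : G.Adj v u) :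
    s(v, u) ∈ (BB l (m + 1)).image (fun x => s(x, p x)) := by
  have h2 := h.step v u ha (by omega)
  have h3 := h.ne v u ha (by omega)
  have h4 := h.step u v ha.symm (by omega)
  simp only [Finset.mem_image, BB, Finset.mem_filter, Finset.mem_univ, true_and]
  by_cases hc : l u = l v + 1
  · have := h.puniq u v (by omega) ha.symm hc.symm
    exact ⟨u, by omega, by rw [← this, Sym2.eq_swap]⟩
  · have := h.puniq v u (by omega) ha (by omega)
    exact ⟨v, by omega, by rw [← this]⟩

theorem e_injOn (h : LevelTree G root (m + 1) l p) :
    Set.InjOn (fun x => s(x, p x)) (BB l (m + 1) : Set V) := by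
  intro x hx y hy hxy
  simp only [BB, Finset.coe_filter, Finset.mem_univ, true_and, Set.mem_setOf_eq] at hx hy
  have h1 := (h.padj x (by omega) (by omega)).2
  have h2 := (h.padj y (by omega) (by omega)).2
  simp only [Sym2.eq_iff] at hxy
  rcases hxy with hxy | ⟨ha, hb⟩
  · exact hxy.1
  · rw [hb] at h1; rw [← ha] at h2; omega

theorem e_sub (h : LevelTree G root (m + 1) l p) :
    (BB l (m + 1)).image (fun x => s(x, p x)) ⊆ G.edgeFinset := by
  intro z hz
  obtain ⟨v, hv, rfl⟩ := Finset.mem_image.1 hz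
  simp only [BB, Finset.mem_filter, Finset.mem_univ, true_and] at hv
  simp only [SimpleGraph.mem_edgeFinset, SimpleGraph.mem_edgeSet]
  exact (h.padj v (by omega) hv.2).1

variable (G) in
noncomputable def aR (μ : V → Finset V → ℝ) (R : Finset (Sym2 V)) (v : V) : ℝ :=
  μ v (nbrsIn G R v)
variable (G) in
noncomputable def bR (μ : V → Finset V → ℝ) (t : ℝ) (p : V → V) (R : Finset (Sym2 V)) (v : V) : ℝ :=
  t * μ v (insert (p v) (nbrsIn G R v))
variable (G) in
noncomputable def KR (μ : V → Finset V → ℝ) (t : ℝ) (l : V → ℕ) (m : ℕ) (R : Finset (Sym2 V)) : ℝ :=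
  t ^ R.card * ∏ v ∈ Finset.univ.filter (fun v => m + 1 < l v), μ v (nbrsIn G R v)

theorem low_child (h : LevelTree G root (m + 1) l p) {X : Finset V} (hX : X ⊆ BB l (m + 1))
    {v u : V} (hv : l v ≤ m) : (G.Adj v u ∧ (u ∈ X ∧ v = p u)) ↔ u ∈ X ∩ chd G l v := by
  rw [Finset.mem_inter]
  constructor
  · rintro ⟨ha, hu, rfl⟩
    refine ⟨hu, ?_⟩
    have hu' := hX hu
    simp only [BB, Finset.mem_filter, Finset.mem_univ, true_and] at hu'
    have := h.padj u (by omega) hu'.2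
    simp only [chd, Finset.mem_filter, SimpleGraph.mem_neighborFinset]
    exact ⟨ha, this.2.symm⟩
  · rintro ⟨hu, hc⟩
    have hu' := hX hu
    simp only [BB, Finset.mem_filter, Finset.mem_univ, true_and] at hu'
    refine ⟨?_, hu, chd_parent h hc hu'.2⟩
    simp only [chd, Finset.mem_filter, SimpleGraph.mem_neighborFinset] at hc
    exact hc.1

theorem nb_low (h : LevelTree G root (m + 1) l p) {R : Finset (Sym2 V)}
    (hR : Disjoint R ((BB l (m + 1)).image (fun x => s(x, p x))))
    {X : Finset V} (hX : X ⊆ BB l (m + 1)) {v : V} (hv : l v ≤ m) :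
    nbrsIn G (R ∪ X.image (fun x => s(x, p x))) v =
      if v ∈ X then insert (p v) (X ∩ chd G l v) else X ∩ chd G l v := by
  ext u
  rw [mem_nbrs_union]
  have h1 : G.Adj v u → s(v, u) ∉ R := fun ha hr =>
    Finset.disjoint_left.1 hR hr (low_edge h hv ha)
  have h2 := low_child h hX (v := v) (u := u) hv
  have h3 : v ∈ X → G.Adj v (p v) := fun hvx => by
    have hu' := hX hvx
    simp only [BB, Finset.mem_filter, Finset.mem_univ, true_and] at hu'
    exact (h.padj v (by omega) hu'.2).1
  by_cases hvx : v ∈ X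
  · rw [if_pos hvx, Finset.mem_insert, ← h2]
    have h3 := h3 hvx
    constructor
    · rintro ⟨ha, hr | hr | hr⟩
      · exact absurd hr (h1 ha)
      · exact Or.inl hr.2
      · exact Or.inr ⟨ha, hr⟩
    · rintro (rfl | hr)
      · exact ⟨h3, Or.inr (Or.inl ⟨hvx, rfl⟩)⟩
      · exact ⟨hr.1, Or.inr (Or.inr hr.2)⟩
  · rw [if_neg hvx, ← h2]
    constructor
    · rintro ⟨ha, hr | hr | hr⟩
      · exact absurd hr (h1 ha)
      · exact absurd hr.1 hvx
      · exact ⟨ha, hr⟩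
    · rintro hr
      exact ⟨hr.1, Or.inr (Or.inr hr.2)⟩

theorem nb_high (h : LevelTree G root (m + 1) l p) {R : Finset (Sym2 V)}
    {X : Finset V} (hX : X ⊆ BB l (m + 1)) {v : V} (hv : m + 1 ≤ l v) :
    nbrsIn G (R ∪ X.image (fun x => s(x, p x))) v =
      if v ∈ X then insert (p v) (nbrsIn G R v) else nbrsIn G R v := by
  ext u
  rw [mem_nbrs_union]
  have h2 : ¬ (u ∈ X ∧ v = p u) := by
    rintro ⟨hu, rfl⟩
    have hu' := hX hu
    simp only [BB, Finset.mem_filter, Finset.mem_univ, true_and] at hu'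
    have := h.padj u (by omega) hu'.2
    omega
  have h3 : v ∈ X → G.Adj v (p v) := fun hvx => by
    have hu' := hX hvx
    simp only [BB, Finset.mem_filter, Finset.mem_univ, true_and] at hu'
    exact (h.padj v (by omega) hu'.2).1
  by_cases hvx : v ∈ X
  · rw [if_pos hvx, Finset.mem_insert, mem_nbrsIn']
    have h3 := h3 hvx
    constructor
    · rintro ⟨ha, hr | hr | hr⟩
      · exact Or.inr ⟨ha, hr⟩
      · exact Or.inl hr.2
      · exact absurd hr h2
    · rintro (rfl | hr)
      · exact ⟨h3, Or.inr (Or.inl ⟨hvx, rfl⟩)⟩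
      · exact ⟨hr.1, Or.inl hr.2⟩
  · rw [if_neg hvx, mem_nbrsIn']
    constructor
    · rintro ⟨ha, hr | hr | hr⟩
      · exact ⟨ha, hr⟩
      · exact absurd hr.1 hvx
      · exact absurd hr h2
    · rintro hr
      exact ⟨hr.1, Or.inl hr.2⟩

theorem erase_split (h : LevelTree G root (m + 1) l p) :
    (Finset.univ : Finset V).erase root =
      (BB l m ∪ Lay l (m + 1)) ∪ Finset.univ.filter (fun v => m + 1 < l v) := by
  ext v
  have := h.zero_iff v
  simp only [Finset.mem_erase, Finset.mem_univ, and_true, Finset.mem_union, BB, Lay,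
    Finset.mem_filter, true_and, ne_eq, ← this]
  omega

theorem global_decomp (h : LevelTree G root (m + 1) l p) (H : Finset V → ℝ) :
    ∑ F ∈ G.edgeFinset.powerset, H (nbrsIn G F root) *
        (∏ v ∈ Finset.univ.erase root, μ v (nbrsIn G F v)) * t ^ F.card =
      ∑ R ∈ (G.edgeFinset \ (BB l (m + 1)).image (fun x => s(x, p x))).powerset,
        KR G μ t l m R * TT G μ t root l p m H (aR G μ R) (bR G μ t p R) := by
  have hun := Finset.sdiff_union_of_subset (e_sub h)
  conv_lhs => rw [← hun]
  rw [sum_powerset_union' _ _ Finset.sdiff_disjoint]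
  refine Finset.sum_congr rfl fun R hR => ?_
  have hRd : Disjoint R ((BB l (m + 1)).image (fun x => s(x, p x))) :=
    Finset.disjoint_of_subset_left (Finset.mem_powerset.1 hR) Finset.sdiff_disjoint
  rw [sum_powerset_image' _ _ (e_injOn h), TT, Finset.mul_sum]
  refine Finset.sum_congr rfl fun X hX => ?_
  have hX := Finset.mem_powerset.1 hX
  have h0 := (h.zero_iff root).2 rfl
  have hr : root ∉ X := fun hrx => by
    have := hX hrx
    simp only [BB, Finset.mem_filter, Finset.mem_univ, true_and] at this
    omega
  rw [nb_low h hRd hX (v := root) (by omega), if_neg hr]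
  have hcard : (R ∪ X.image (fun x => s(x, p x))).card = R.card + X.card := by
    rw [Finset.card_union_of_disjoint, Finset.card_image_of_injOn]
    · exact (e_injOn h).mono (by exact_mod_cast hX)
    · exact Finset.disjoint_of_subset_right (Finset.image_subset_image hX) hRd
  have hXe : X ⊆ Finset.univ.erase root := fun x hx =>
    Finset.mem_erase.2 ⟨by rintro rfl; exact hr hx, Finset.mem_univ _⟩
  have hpow : t ^ X.card = ∏ v ∈ Finset.univ.erase root, if v ∈ X then t else 1 := by
    rw [Finset.prod_ite_mem, Finset.inter_eq_right.2 hXe, Finset.prod_const]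
  have hprod : (∏ v ∈ Finset.univ.erase root, μ v (nbrsIn G (R ∪ X.image (fun x => s(x, p x))) v))
      * t ^ X.card = (∏ v ∈ BB l m, psi G μ t l p v X) *
      (∏ v ∈ Lay l (m + 1), if v ∈ X then bR G μ t p R v else aR G μ R v) *
      ∏ v ∈ Finset.univ.filter (fun v => m + 1 < l v), μ v (nbrsIn G R v) := by
    rw [hpow, ← Finset.prod_mul_distrib, erase_split h, Finset.prod_union, Finset.prod_union]
    · congr 1
      · congr 1
        · refine Finset.prod_congr rfl fun v hv => ?_
          simp only [BB, Finset.mem_filter, Finset.mem_univ, true_and] at hv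
          rw [nb_low h hRd hX hv.2, psi]
          split_ifs <;> ring
        · refine Finset.prod_congr rfl fun v hv => ?_
          simp only [Lay, Finset.mem_filter, Finset.mem_univ, true_and] at hv
          rw [nb_high h hX hv.ge, aR, bR]
          split_ifs <;> ring
      · refine Finset.prod_congr rfl fun v hv => ?_
        simp only [Finset.mem_filter, Finset.mem_univ, true_and] at hv
        have : v ∉ X := fun hvx => by
          have := hX hvx
          simp only [BB, Finset.mem_filter, Finset.mem_univ, true_and] at this
          omega
        rw [nb_high h hX hv.le, if_neg this, if_neg this, mul_one]
    · exact BB_Lay_disj m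
    · rw [Finset.disjoint_left]
      intro v
      simp only [BB, Lay, Finset.mem_filter, Finset.mem_univ, true_and, Finset.mem_union]
      omega
  rw [hcard, pow_add, KR]
  linear_combination (H (X ∩ chd G l root) * t ^ R.card) * hprod

theorem nb_nonneg (hcm : ∀ i : V, lCavityMonotone (G.neighborFinset i) (μ i))
    (R : Finset (Sym2 V)) (v : V) : 0 ≤ μ v (nbrsIn G R v) := by
  refine (hcm v).1 _ (Finset.mem_powerset.2 fun u hu => ?_)
  rw [SimpleGraph.mem_neighborFinset]
  exact ((mem_nbrsIn' R v u).1 hu).1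

theorem KR_nonneg (hcm : ∀ i : V, lCavityMonotone (G.neighborFinset i) (μ i)) (ht : 0 < t)
    (R : Finset (Sym2 V)) : 0 ≤ KR G μ t l m R :=
  mul_nonneg (pow_nonneg ht.le _) (Finset.prod_nonneg fun v _ => nb_nonneg hcm R v)

theorem bR_nonneg (hcm : ∀ i : V, lCavityMonotone (G.neighborFinset i) (μ i)) (ht : 0 < t)
    (R : Finset (Sym2 V)) {v : V} (hv : G.Adj v (p v)) : 0 ≤ bR G μ t p R v := by
  refine mul_nonneg ht.le ((hcm v).1 _ (Finset.mem_powerset.2 fun u hu => ?_))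
  rw [SimpleGraph.mem_neighborFinset]
  rcases Finset.mem_insert.1 hu with rfl | hu
  · exact hv
  · exact ((mem_nbrsIn' R v u).1 hu).1

theorem lZ_neg' (A : Finset V) (f : Finset V → ℝ) (x : V → ℝ) :
    lZ A (fun S => - f S) x = - lZ A f x := by
  simp [lZ]

theorem pS_neg' (A : Finset V) (f : Finset V → ℝ) (a b : V → ℝ) :
    pS A (fun S => - f S) a b = - pS A f a b := by
  simp [pS]

theorem ZG_pos (hcm : ∀ i : V, lCavityMonotone (G.neighborFinset i) (μ i)) (ht : 0 < t) :
    0 < ZG G μ t := by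
  unfold ZG
  refine Finset.sum_pos' (fun F _ => mul_nonneg
    (Finset.prod_nonneg fun v _ => nb_nonneg hcm F v) (pow_nonneg ht.le _))
    ⟨∅, Finset.empty_mem_powerset _, mul_pos (Finset.prod_pos fun v _ => ?_) (pow_pos ht _)⟩
  have : nbrsIn G ∅ v = ∅ := by simp [nbrsIn]
  rw [this]
  exact (hcm v).2.1

theorem main_bounds (hcm : ∀ i : V, lCavityMonotone (G.neighborFinset i) (μ i)) (ht : 0 < t)
    (k : ℕ) (h : LevelTree G root (2 * k + 2) l p) :
    lEnergy (G.neighborFinset root) (μ root) (fun j => XX G μ t (2 * k) j root) * ZG G μ t ≤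
      (∑ F ∈ G.edgeFinset.powerset,
          ((nbrsIn G F root).card : ℝ) * gWeight G μ F * t ^ F.card) ∧
    (∑ F ∈ G.edgeFinset.powerset,
        ((nbrsIn G F root).card : ℝ) * gWeight G μ F * t ^ F.card) ≤
      lEnergy (G.neighborFinset root) (μ root)
        (fun j => XX G μ t (2 * k + 1) j root) * ZG G μ t := by
  have hZ : ZG G μ t = _ := (Finset.sum_congr rfl fun F _ => by
    rw [gWeight, ← Finset.mul_prod_erase _ _ (Finset.mem_univ root)]).trans
      (global_decomp (μ := μ) (t := t) (m := 2 * k + 1) h (μ root))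
  have hN : (∑ F ∈ G.edgeFinset.powerset,
      ((nbrsIn G F root).card : ℝ) * gWeight G μ F * t ^ F.card) = _ :=
    (Finset.sum_congr rfl fun F _ => by
      rw [gWeight, ← Finset.mul_prod_erase _ _ (Finset.mem_univ root), ← mul_assoc]).trans
      (global_decomp (μ := μ) (t := t) (m := 2 * k + 1) h (fun S => (S.card : ℝ) * μ root S))
  rw [hN, hZ, Finset.mul_sum, Finset.mul_sum]
  have hx : ∀ j, ∀ v ∈ G.neighborFinset root, 0 ≤ XX G μ t j v root := by
    intro j v hv
    rw [SimpleGraph.mem_neighborFinset] at hv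
    exact XX_nonneg hcm ht j v root hv.symm
  have hpos : ∀ j, 0 < lZ (G.neighborFinset root) (μ root) (fun v => XX G μ t j v root) :=
    fun j => lZ_pos _ _ (hcm root).1 (hcm root).2.1 _ (hx j)
  have hE : ∀ j, lEnergy (G.neighborFinset root) (μ root) (fun v => XX G μ t j v root) =
    lZ (G.neighborFinset root) (fun S => (S.card : ℝ) * μ root S) (fun v => XX G μ t j v root) /
    lZ (G.neighborFinset root) (μ root) (fun v => XX G μ t j v root) := fun j => rfl
  have key := fun R : Finset (Sym2 V) => bound_final hcm ht k h (aR G μ R) (bR G μ t p R)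
    (fun v _ => nb_nonneg hcm R v) (fun v hv => bR_nonneg hcm ht R (by
      simp only [Lay, Finset.mem_filter, Finset.mem_univ, true_and] at hv
      exact (h.padj v (by omega) (by omega)).1))
  constructor
  · refine Finset.sum_le_sum fun R _ => ?_
    obtain ⟨a0, b0, hT, hB⟩ := key R
    have := (pS_mono (cm_energy (hcm root)) (hcm root).1 (hcm root).2.1 a0 b0
      (fun v => XX G μ t (2 * k) v root) (fun v hv => (hB v hv).1) (fun v hv => (hB v hv).2.1)
      (hx _)).1 (fun v hv => (hB v hv).2.2.1)
    rw [pS_neg', lZ_neg'] at this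
    rw [hT, hT, mul_left_comm]
    refine mul_le_mul_of_nonneg_left ?_ (KR_nonneg hcm ht R)
    rw [hE, div_mul_eq_mul_div, div_le_iff₀ (hpos _)]
    linarith
  · refine Finset.sum_le_sum fun R _ => ?_
    obtain ⟨a0, b0, hT, hB⟩ := key R
    have := (pS_mono (cm_energy (hcm root)) (hcm root).1 (hcm root).2.1 a0 b0
      (fun v => XX G μ t (2 * k + 1) v root) (fun v hv => (hB v hv).1) (fun v hv => (hB v hv).2.1)
      (hx _)).2 (fun v hv => (hB v hv).2.2.2)
    rw [pS_neg', lZ_neg'] at this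
    rw [hT, hT, mul_left_comm]
    refine mul_le_mul_of_nonneg_left ?_ (KR_nonneg hcm ht R)
    rw [hE, div_mul_eq_mul_div, le_div_iff₀ (hpos _)]
    linarith

end Part4

/-- tree approximation. If the ball of radius `2k+2` around the root is a
tree, the even/odd cavity iterates from `0` sandwich the expected local degree
`E^t_G[|𝓕 ∩ E_∘|]` of the root under the Gibbs--Boltzmann law. -/
theorem stmt12 {V : Type*} [Fintype V] [DecidableEq V] (G : SimpleGraph V)
    [DecidableRel G.Adj] (μ : V → Finset V → ℝ)
    (hcm : ∀ i : V, lCavityMonotone (G.neighborFinset i) (μ i))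
    (root : V) (k : ℕ)
    (hball : (G.induce {v : V | G.Reachable root v ∧ G.dist root v ≤ 2 * k + 2}).IsTree)
    (t : ℝ) (ht : 0 < t) :
    lEnergy (G.neighborFinset root) (μ root)
        (fun j => (cavStep G μ t)^[2 * k] (fun _ _ => 0) j root) ≤
      (∑ F ∈ G.edgeFinset.powerset,
          ((nbrsIn G F root).card : ℝ) * gWeight G μ F * t ^ F.card) / ZG G μ t ∧
    (∑ F ∈ G.edgeFinset.powerset,
        ((nbrsIn G F root).card : ℝ) * gWeight G μ F * t ^ F.card) / ZG G μ t ≤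
      lEnergy (G.neighborFinset root) (μ root)
        (fun j => (cavStep G μ t)^[2 * k + 1] (fun _ _ => 0) j root) := by
  obtain ⟨l, p, h⟩ := exists_levelTree G root (2 * k + 2) hball
  have hb := main_bounds hcm ht k h
  exact ⟨(le_div_iff₀ (ZG_pos hcm ht)).2 hb.1, (div_le_iff₀ (ZG_pos hcm ht)).2 hb.2⟩
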